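/- For every natural number n ≥ 1 there exists a rooted tree S′ with at most 2n² − 1 vertices and with one distinguished (marked) leaf vertex w, such that for every rooted binary tree T with at most n vertices and one marked leaf there is an injective map φ : V(T) → V(S′) mapping the marked leaf of T to w and satisfying φ(nca_T(u,v)) = nca_{S′}(φ(u), φ(v)) for all vertices u, v of T. -/

import Mathlib

/-- `u` is an ancestor of `v` w.r.t. the parent function `p`
(every vertex is an ancestor of itself, via `k = 0`). -/
def IsAncestorOf {V : Type*} (p : V → V) (u v : V) : Prop := ∃ k : ℕ, p^[k] v = u

/-- `w` is the nearest common ancestor of `u` and `v` w.r.t. the parent function `p`: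
`w` is a common ancestor and every common ancestor of `u` and `v` is an ancestor of `w`
(i.e. `w` is the common ancestor furthest from the root). -/
def IsNcaOf {V : Type*} (p : V → V) (u v w : V) : Prop :=
  IsAncestorOf p w u ∧ IsAncestorOf p w v ∧
    ∀ x, IsAncestorOf p x u → IsAncestorOf p x v → IsAncestorOf p x w

/-- A finite rooted tree, encoded by a parent function on `Fin n`:
the root is its own parent and every vertex reaches the root by iterating `parent`. -/
structure FinRootedTree where
  n : ℕ
  pos : 0 < n
  parent : Fin n → Fin n
  root : Fin n
  parent_root : parent root = root
  reaches_root : ∀ v, ∃ k : ℕ, parent^[k] v = root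

namespace FinRootedTree

def IsAncestor (T : FinRootedTree) (u v : Fin T.n) : Prop := IsAncestorOf T.parent u v

def IsNCA (T : FinRootedTree) (u v w : Fin T.n) : Prop := IsNcaOf T.parent u v w

end FinRootedTree

/-- An NCA-preserving embedding of `T` into `S`: an injective map on the vertices
that commutes with the nearest-common-ancestor function. -/
def NcaEmbedding (T S : FinRootedTree) (φ : Fin T.n → Fin S.n) : Prop :=
  Function.Injective φ ∧ ∀ u v w, T.IsNCA u v w → S.IsNCA (φ u) (φ v) (φ w)

namespace FinRootedTree

/-- A rooted tree is binary if every vertex has at most two children. -/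
def IsBinary (T : FinRootedTree) : Prop :=
  ∀ v : Fin T.n, {u : Fin T.n | T.parent u = v ∧ u ≠ v}.ncard ≤ 2

/-- A leaf is a vertex with no children. -/
def IsLeaf (T : FinRootedTree) (w : Fin T.n) : Prop := ∀ u, T.parent u = w → u = w

end FinRootedTree

/-- Shapes of binary trees with ordered, possibly missing children; `nil` is the empty tree. -/
inductive BinShape where
  | nil : BinShape
  | node (l r : BinShape) : BinShape

namespace BinShape

/-- The number of vertices. -/
def size : BinShape → ℕ
  | nil => 0
  | node l r => 1 + l.size + r.size

/-- The vertices of a shape, as lists of left (`false`) / right (`true`) turns from the root. -/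
def addr : BinShape → Finset (List Bool)
  | nil => ∅
  | node l r => insert [] (l.addr.image (List.cons false) ∪ r.addr.image (List.cons true))

@[simp] theorem notMem_addr_nil (x : List Bool) : x ∉ nil.addr := by simp [addr]

@[simp] theorem nil_mem_addr_node (l r : BinShape) : [] ∈ (node l r).addr := by simp [addr]

@[simp] theorem false_cons_mem_addr_node (l r : BinShape) (x : List Bool) :
    false :: x ∈ (node l r).addr ↔ x ∈ l.addr := by simp [addr]

@[simp] theorem true_cons_mem_addr_node (l r : BinShape) (x : List Bool) :
    true :: x ∈ (node l r).addr ↔ x ∈ r.addr := by simp [addr]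

theorem card_addr (t : BinShape) : t.addr.card = t.size := by
  induction t with
  | nil => rfl
  | node l r ihl ihr =>
    rw [addr, Finset.card_insert_of_notMem (by simp), Finset.card_union_of_disjoint,
      Finset.card_image_of_injective _ List.cons_injective,
      Finset.card_image_of_injective _ List.cons_injective, ihl, ihr, size]
    · omega
    · rw [Finset.disjoint_left]
      simp

theorem mem_addr_of_prefix {t : BinShape} {x y : List Bool} (h : x <+: y) (hy : y ∈ t.addr) :
    x ∈ t.addr := by
  induction t generalizing x y with
  | nil => simp at hy
  | node l r ihl ihr =>
    rcases x with _ | ⟨b, x⟩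
    · simp
    · rcases y with _ | ⟨b', y⟩
      · simp at h
      · obtain ⟨rfl, hxy⟩ := List.cons_prefix_cons.1 h
        cases b
        · simp only [false_cons_mem_addr_node] at hy ⊢
          exact ihl hxy hy
        · simp only [true_cons_mem_addr_node] at hy ⊢
          exact ihr hxy hy

/-- The longest common prefix of two addresses. -/
def lcp : List Bool → List Bool → List Bool
  | a :: x, b :: y => if a = b then a :: lcp x y else []
  | _, _ => []

@[simp] theorem lcp_nil_left (x : List Bool) : lcp [] x = [] := by simp [lcp]

@[simp] theorem lcp_nil_right (x : List Bool) : lcp x [] = [] := by cases x <;> simp [lcp]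

@[simp] theorem lcp_cons_cons (a b : Bool) (x y : List Bool) :
    lcp (a :: x) (b :: y) = if a = b then a :: lcp x y else [] := by simp [lcp]

theorem prefix_lcp_iff {x y z : List Bool} : z <+: lcp x y ↔ z <+: x ∧ z <+: y := by
  induction z generalizing x y with
  | nil => simp
  | cons c z ih =>
    rcases x with _ | ⟨a, x⟩
    · simp
    rcases y with _ | ⟨b, y⟩
    · simp
    by_cases hab : a = b
    · subst hab
      simp only [lcp_cons_cons, if_true, List.cons_prefix_cons, ih]
      tauto
    · simp only [lcp_cons_cons, if_neg hab, List.cons_prefix_cons]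
      simp only [List.prefix_nil, reduceCtorEq, false_iff]
      rintro ⟨⟨rfl, -⟩, rfl, -⟩
      exact hab rfl

/-- `e` embeds the vertices of `t` into those of `s`, preserving nearest common ancestors. -/
structure IsEmb (e : List Bool → List Bool) (t s : BinShape) : Prop where
  mem : ∀ x ∈ t.addr, e x ∈ s.addr
  inj : ∀ x ∈ t.addr, ∀ y ∈ t.addr, e x = e y → x = y
  map_lcp : ∀ x ∈ t.addr, ∀ y ∈ t.addr, e (lcp x y) = lcp (e x) (e y)

/-- The map between two nodes induced by maps between the children, where the children trade
places if `b` is `true`. -/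
def nodeMap (b : Bool) (e f : List Bool → List Bool) : List Bool → List Bool
  | [] => []
  | false :: x => b :: e x
  | true :: x => (!b) :: f x

theorem IsEmb.nil (e : List Bool → List Bool) (s : BinShape) : IsEmb e nil s :=
  ⟨by simp, by simp, by simp⟩

theorem IsEmb.id (t : BinShape) : IsEmb id t t :=
  ⟨fun _ h => h, fun _ _ _ _ h => h, fun _ _ _ _ => rfl⟩

theorem IsEmb.comp {e f : List Bool → List Bool} {t s r : BinShape} (hf : IsEmb f s r)
    (he : IsEmb e t s) : IsEmb (f ∘ e) t r where
  mem x hx := hf.mem _ (he.mem x hx)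
  inj x hx y hy h := he.inj x hx y hy (hf.inj _ (he.mem x hx) _ (he.mem y hy) h)
  map_lcp x hx y hy := by
    simp only [Function.comp_apply, he.map_lcp x hx y hy,
      hf.map_lcp _ (he.mem x hx) _ (he.mem y hy)]

theorem IsEmb.node {e f : List Bool → List Bool} {l r l' r' : BinShape} (he : IsEmb e l l')
    (hf : IsEmb f r r') : IsEmb (nodeMap false e f) (node l r) (node l' r') where
  mem := by
    rintro (_ | ⟨_ | _, x⟩) hx <;> simp [nodeMap] at hx ⊢
    · exact he.mem x hx
    · exact hf.mem x hx
  inj := by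
    rintro (_ | ⟨_ | _, x⟩) hx (_ | ⟨_ | _, y⟩) hy h <;> simp [nodeMap] at hx hy h ⊢
    · exact he.inj x hx y hy h
    · exact hf.inj x hx y hy h
  map_lcp := by
    rintro (_ | ⟨_ | _, x⟩) hx (_ | ⟨_ | _, y⟩) hy <;> simp [nodeMap] at hx hy ⊢
    · exact he.map_lcp x hx y hy
    · exact hf.map_lcp x hx y hy

theorem IsEmb.node_swap {e f : List Bool → List Bool} {l r l' r' : BinShape} (he : IsEmb e l r')
    (hf : IsEmb f r l') : IsEmb (nodeMap true e f) (BinShape.node l r) (BinShape.node l' r') where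
  mem := by
    rintro (_ | ⟨_ | _, x⟩) hx <;> simp [nodeMap] at hx ⊢
    · exact he.mem x hx
    · exact hf.mem x hx
  inj := by
    rintro (_ | ⟨_ | _, x⟩) hx (_ | ⟨_ | _, y⟩) hy h <;> simp [nodeMap] at hx hy h ⊢
    · exact he.inj x hx y hy h
    · exact hf.inj x hx y hy h
  map_lcp := by
    rintro (_ | ⟨_ | _, x⟩) hx (_ | ⟨_ | _, y⟩) hy <;> simp [nodeMap] at hx hy ⊢
    · exact he.map_lcp x hx y hy
    · exact hf.map_lcp x hx y hy

theorem IsEmb.skip_left {e : List Bool → List Bool} {t l : BinShape} (he : IsEmb e t l)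
    (r : BinShape) : IsEmb (fun x => false :: e x) t (BinShape.node l r) where
  mem x hx := by simpa using he.mem x hx
  inj x hx y hy h := he.inj x hx y hy (by simpa using h)
  map_lcp x hx y hy := by simpa using he.map_lcp x hx y hy

theorem IsEmb.skip_right {e : List Bool → List Bool} {t r : BinShape} (he : IsEmb e t r)
    (l : BinShape) : IsEmb (fun x => true :: e x) t (BinShape.node l r) where
  mem x hx := by simpa using he.mem x hx
  inj x hx y hy h := he.inj x hx y hy (by simpa using h)
  map_lcp x hx y hy := by simpa using he.map_lcp x hx y hy

/-- `t` embeds into `s`, preserving nearest common ancestors. -/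
def Emb (t s : BinShape) : Prop := ∃ e, IsEmb e t s

theorem Emb.refl (t : BinShape) : Emb t t := ⟨_, IsEmb.id t⟩

theorem Emb.trans {t s r : BinShape} : Emb t s → Emb s r → Emb t r :=
  fun ⟨_, he⟩ ⟨_, hf⟩ => ⟨_, hf.comp he⟩

/-- The tree whose root path consists of vertices with left subtrees `c` and ends in `x`. -/
def plug : List BinShape → BinShape → BinShape
  | [], x => x
  | t :: c, x => node t (plug c x)

/-- The number of vertices that `plug c` adds. -/
def cost (c : List BinShape) : ℕ := (c.map fun t => 1 + t.size).sum

@[simp] theorem cost_nil : cost [] = 0 := rfl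

@[simp] theorem cost_cons (t : BinShape) (c : List BinShape) :
    cost (t :: c) = 1 + t.size + cost c := by simp [cost]

@[simp] theorem cost_append (c d : List BinShape) : cost (c ++ d) = cost c + cost d := by
  simp [cost]

theorem size_plug (c : List BinShape) (x : BinShape) : (plug c x).size = cost c + x.size := by
  induction c with
  | nil => simp [plug]
  | cons t c ih => simp only [plug, size, ih, cost_cons]; omega

theorem IsEmb.plug {c C : List BinShape} (h : List.SublistForall₂ Emb c C) {x y : BinShape}
    {e : List Bool → List Bool} (he : IsEmb e x y) :
    ∃ f, IsEmb f (plug c x) (plug C y) ∧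
      ∀ a, f (List.replicate c.length true ++ a) = List.replicate C.length true ++ e a := by
  induction h with
  | @nil C =>
    induction C with
    | nil => exact ⟨e, he, fun a => rfl⟩
    | cons t C ih =>
      obtain ⟨f, hf, hm⟩ := ih
      refine ⟨_, hf.skip_right t, fun a => ?_⟩
      simp only [hm, List.length_cons, List.replicate_succ, List.cons_append]
  | cons ht _ ih =>
    obtain ⟨g, hg⟩ := ht
    obtain ⟨f, hf, hm⟩ := ih
    refine ⟨_, hg.node hf, fun a => ?_⟩
    simp only [List.length_cons, List.replicate_succ, List.cons_append, nodeMap, hm, Bool.not_false]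
  | cons_right _ ih =>
    obtain ⟨f, hf, hm⟩ := ih
    refine ⟨_, hf.skip_right _, fun a => ?_⟩
    simp only [hm, List.length_cons, List.replicate_succ, List.cons_append]

theorem Emb.plug {c C : List BinShape} (h : List.SublistForall₂ Emb c C) {x y : BinShape} :
    Emb x y → Emb (plug c x) (plug C y) :=
  fun ⟨_, he⟩ => let ⟨f, hf, _⟩ := he.plug h; ⟨f, hf⟩

theorem sublistForall₂_append_left {α : Type*} {R : α → α → Prop} {c C : List α} (D : List α)
    (h : List.SublistForall₂ R c C) : List.SublistForall₂ R c (D ++ C) := by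
  induction D with
  | nil => exact h
  | cons a D ih => exact ih.cons_right

theorem sublistForall₂_append {α : Type*} {R : α → α → Prop} {c C d D : List α}
    (h : List.SublistForall₂ R c C) (h' : List.SublistForall₂ R d D) :
    List.SublistForall₂ R (c ++ d) (C ++ D) := by
  induction h with
  | nil => exact sublistForall₂_append_left _ h'
  | cons hr _ ih => exact ih.cons hr
  | cons_right _ ih => exact ih.cons_right

/-- Walking down from the root into subtrees with more than `m` vertices, one arrives at a vertex
both of whose subtrees have at most `m` vertices. -/
theorem exists_emb_plug (m : ℕ) (t : BinShape) (ht : m < t.size) :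
    ∃ c l r, l.size ≤ m ∧ r.size ≤ l.size ∧ m ≤ l.size + r.size ∧
      cost c + (1 + l.size + r.size) = t.size ∧ Emb t (plug c (node l r)) := by
  induction t with
  | nil => simp [size] at ht
  | node a b iha ihb =>
    simp only [size] at ht ⊢
    by_cases ha : m < a.size
    · obtain ⟨c, l, r, h1, h2, h3, h4, e, he⟩ := iha ha
      refine ⟨b :: c, l, r, h1, h2, h3, ?_, _, he.node_swap (IsEmb.id b)⟩
      rw [cost_cons]; omega
    by_cases hb : m < b.size
    · obtain ⟨c, l, r, h1, h2, h3, h4, e, he⟩ := ihb hb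
      refine ⟨a :: c, l, r, h1, h2, h3, ?_, _, (IsEmb.id a).node he⟩
      rw [cost_cons]; omega
    rcases le_total b.size a.size with h | h
    · exact ⟨[], a, b, by omega, h, by omega, by simp, Emb.refl _⟩
    · exact ⟨[], b, a, by omega, h, by omega, by simp; omega, _,
        (IsEmb.id a).node_swap (IsEmb.id b)⟩

/-- A list of total cost more than `k` splits at the element that passes the threshold. -/
theorem exists_split_of_lt_cost (k : ℕ) (c : List BinShape) (h : k < cost c) :
    ∃ c₁ t c₂, c = c₁ ++ t :: c₂ ∧ cost c₂ ≤ k ∧ k < 1 + t.size + cost c₂ := by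
  induction c with
  | nil => simp at h
  | cons t c ih =>
    by_cases hc : k < cost c
    · obtain ⟨c₁, u, c₂, rfl, h1, h2⟩ := ih hc
      exact ⟨t :: c₁, u, c₂, rfl, h1, h2⟩
    · exact ⟨[], t, c, rfl, by omega, by rwa [cost_cons] at h⟩

theorem exists_universal (n : ℕ) :
    (∃ A : BinShape, A.size ≤ n ^ 2 ∧ ∀ t : BinShape, t.size ≤ n → Emb t A) ∧
    (1 ≤ n → ∃ C : List BinShape, cost C + 2 ≤ 2 * n ^ 2 ∧
      ∀ c, cost c + 1 ≤ n → List.SublistForall₂ Emb c C) := by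
  have hnil : ∀ t : BinShape, t.size ≤ 0 → t = nil := by
    rintro (_ | ⟨l, r⟩) h
    · rfl
    · simp [size] at h
  induction n using Nat.strong_induction_on with
  | _ n ih =>
  rcases Nat.lt_or_ge n 2 with hn | hn
  · interval_cases n
    · refine ⟨⟨nil, by simp [size], fun t ht => ?_⟩, by simp⟩
      rw [hnil t ht]
      exact Emb.refl _
    · refine ⟨⟨node nil nil, by simp [size], ?_⟩, fun _ => ⟨[], by simp, ?_⟩⟩
      · rintro (_ | ⟨l, r⟩) h
        · exact ⟨_, IsEmb.nil id _⟩
        · simp only [size] at h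
          rw [hnil l (by omega), hnil r (by omega)]
          exact Emb.refl _
      · rintro (_ | ⟨t, c⟩) h
        · exact .nil
        · rw [cost_cons] at h
          omega
  obtain ⟨h, hh⟩ : ∃ h, h = n / 2 := ⟨_, rfl⟩
  obtain ⟨C₁, hC₁, uC₁⟩ := (ih h (by omega)).2 (by omega)
  constructor
  · obtain ⟨A₁, hA₁, uA₁⟩ := (ih (n - h) (by omega)).1
    obtain ⟨A₂, hA₂, uA₂⟩ := (ih ((n - 1) / 2) (by omega)).1
    refine ⟨plug C₁ (node A₁ A₂), ?_, fun t ht => ?_⟩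
    · rw [size_plug, size]
      rcases Nat.even_or_odd' n with ⟨k, rfl | rfl⟩
      · obtain rfl : h = k := by omega
        obtain ⟨j, rfl⟩ : ∃ j, h = j + 1 := ⟨h - 1, by omega⟩
        rw [show 2 * (j + 1) - (j + 1) = j + 1 by omega] at hA₁
        rw [show (2 * (j + 1) - 1) / 2 = j by omega] at hA₂
        nlinarith
      · obtain rfl : h = k := by omega
        rw [show 2 * h + 1 - h = h + 1 by omega] at hA₁
        rw [show (2 * h + 1 - 1) / 2 = h by omega] at hA₂
        nlinarith
    · by_cases hs : t.size ≤ n - h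
      · obtain ⟨e, he⟩ := uA₁ t hs
        obtain ⟨f, hf, -⟩ := (he.skip_left A₂).plug (.nil (l := C₁))
        exact ⟨f, hf⟩
      · obtain ⟨c, l, r, h1, h2, h3, h4, ht'⟩ := exists_emb_plug (n - h) t (by omega)
        obtain ⟨e, he⟩ := uA₁ l h1
        obtain ⟨f, hf⟩ := uA₂ r (by omega)
        exact ht'.trans (Emb.plug (uC₁ c (by omega)) ⟨_, he.node hf⟩)
  · intro _
    obtain ⟨C₂, hC₂, uC₂⟩ := (ih (n - h) (by omega)).2 (by omega)
    obtain ⟨A, hA, uA⟩ := (ih (n - 2) (by omega)).1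
    refine ⟨C₂ ++ A :: C₁, ?_, fun c hc => ?_⟩
    · rw [cost_append, cost_cons]
      obtain ⟨m, rfl⟩ : ∃ m, n = m + 2 := ⟨n - 2, by omega⟩
      rw [Nat.add_sub_cancel] at hA
      rcases Nat.even_or_odd' m with ⟨k, rfl | rfl⟩
      · obtain rfl : h = k + 1 := by omega
        rw [show 2 * k + 2 - (k + 1) = k + 1 by omega] at hC₂
        nlinarith
      · obtain rfl : h = k + 1 := by omega
        rw [show 2 * k + 1 + 2 - (k + 1) = k + 2 by omega] at hC₂
        nlinarith
    · by_cases hs : cost c + 1 ≤ h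
      · exact sublistForall₂_append_left C₂ (uC₁ c hs).cons_right
      · obtain ⟨c₁, t, c₂, rfl, h1, h2⟩ := exists_split_of_lt_cost (h - 1) c (by omega)
        rw [cost_append, cost_cons] at hc
        exact sublistForall₂_append (uC₂ c₁ (by omega))
          ((uC₁ c₂ (by omega)).cons (uA t (by omega)))

theorem isAncestorOf_dropLast_iff {x y : List Bool} :
    IsAncestorOf List.dropLast x y ↔ x <+: y := by
  have key : ∀ k (y : List Bool), List.dropLast^[k] y = y.take (y.length - k) := by
    intro k
    induction k with
    | zero => simp
    | succ k ih =>
      intro y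
      rw [Function.iterate_succ_apply', ih, List.dropLast_eq_take, List.take_take]
      congr 1
      simp only [List.length_take]
      omega
  constructor
  · rintro ⟨k, rfl⟩
    rw [key]
    exact List.take_prefix _ _
  · intro h
    refine ⟨y.length - x.length, ?_⟩
    rw [key, Nat.sub_sub_self h.length_le]
    exact (List.prefix_iff_eq_take.1 h).symm

/-- The parent function on the vertices of a shape. -/
def parent (s : BinShape) (x : s.addr) : s.addr :=
  ⟨x.1.dropLast, mem_addr_of_prefix (List.dropLast_prefix _) x.2⟩

theorem coe_parent_iterate (s : BinShape) (k : ℕ) (x : s.addr) :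
    ((s.parent^[k] x : s.addr) : List Bool) = List.dropLast^[k] x.1 := by
  induction k with
  | zero => rfl
  | succ k ih => rw [Function.iterate_succ_apply', Function.iterate_succ_apply', ← ih]; rfl

theorem conj_iterate {α β : Type*} (e : α ≃ β) (p : α → α) (k : ℕ) (x : α) :
    (fun i => e (p (e.symm i)))^[k] (e x) = e (p^[k] x) := by
  induction k with
  | zero => rfl
  | succ k ih => rw [Function.iterate_succ_apply', ih, Function.iterate_succ_apply']; simp

/-- A nonempty shape as a rooted tree. -/
noncomputable def toTree (s : BinShape) (h : [] ∈ s.addr) : FinRootedTree where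
  n := s.addr.card
  pos := Finset.card_pos.2 ⟨_, h⟩
  parent i := s.addr.equivFin (s.parent (s.addr.equivFin.symm i))
  root := s.addr.equivFin ⟨[], h⟩
  parent_root := by simp [parent]
  reaches_root := by
    intro i
    obtain ⟨x, rfl⟩ := s.addr.equivFin.surjective i
    obtain ⟨k, hk⟩ := isAncestorOf_dropLast_iff.2 (List.nil_prefix (l := x.1))
    refine ⟨k, ?_⟩
    rw [conj_iterate]
    congr 1
    exact Subtype.ext (by rw [coe_parent_iterate, hk])

/-- The vertex of `s.toTree h` with a given address. -/
noncomputable def vertex (s : BinShape) (h : [] ∈ s.addr) : s.addr ≃ Fin (s.toTree h).n :=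
  s.addr.equivFin

theorem isAncestor_vertex (s : BinShape) (h : [] ∈ s.addr) (x y : s.addr) :
    (s.toTree h).IsAncestor (s.vertex h x) (s.vertex h y) ↔ x.1 <+: y.1 := by
  rw [← isAncestorOf_dropLast_iff]
  refine exists_congr fun k => ?_
  rw [← coe_parent_iterate, Subtype.coe_inj, ← (s.vertex h).injective.eq_iff]
  exact Eq.congr_left (conj_iterate s.addr.equivFin s.parent k y)

theorem isNCA_vertex (s : BinShape) (h : [] ∈ s.addr) (x y z : s.addr)
    (hz : z.1 = lcp x.1 y.1) :
    (s.toTree h).IsNCA (s.vertex h x) (s.vertex h y) (s.vertex h z) := by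
  obtain ⟨hx, hy⟩ := prefix_lcp_iff.1 (List.prefix_refl (lcp x.1 y.1))
  refine ⟨(s.isAncestor_vertex h _ _).2 (hz ▸ hx), (s.isAncestor_vertex h _ _).2 (hz ▸ hy), ?_⟩
  intro i hi hj
  obtain ⟨u, rfl⟩ := (s.vertex h).surjective i
  have hu := (s.isAncestor_vertex h _ _).1 hi
  have hv := (s.isAncestor_vertex h _ _).1 hj
  exact (s.isAncestor_vertex h _ _).2 (hz ▸ prefix_lcp_iff.2 ⟨hu, hv⟩)

theorem replicate_mem_addr_plug (c : List BinShape) :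
    List.replicate c.length true ∈ (plug c (node nil nil)).addr := by
  induction c with
  | nil => simp [plug]
  | cons t c ih => simpa [plug, List.replicate_succ] using ih

theorem eq_replicate_of_prefix (c : List BinShape) {x : List Bool}
    (hx : x ∈ (plug c (node nil nil)).addr) (h : List.replicate c.length true <+: x) :
    x = List.replicate c.length true := by
  induction c generalizing x with
  | nil => simpa [plug, addr] using hx
  | cons t c ih =>
    rcases x with _ | ⟨b, x⟩
    · simp [List.replicate_succ] at h
    · simp only [List.length_cons, List.replicate_succ, List.cons_prefix_cons] at h ⊢
      obtain ⟨rfl, h⟩ := h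
      rw [ih (by simpa [plug] using hx) h]

theorem isLeaf_vertex (c : List BinShape) (h : [] ∈ (plug c (node nil nil)).addr) :
    ((plug c (node nil nil)).toTree h).IsLeaf
      ((plug c (node nil nil)).vertex h ⟨_, replicate_mem_addr_plug c⟩) := by
  intro i hi
  obtain ⟨x, rfl⟩ := ((plug c (node nil nil)).vertex h).surjective i
  congr 1
  exact Subtype.ext (eq_replicate_of_prefix c x.2
    ((isAncestor_vertex _ h ⟨_, replicate_mem_addr_plug c⟩ x).1 ⟨1, hi⟩))

end BinShape

namespace FinRootedTree

open BinShape

variable (T : FinRootedTree)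

theorem isAncestor_refl (v : Fin T.n) : T.IsAncestor v v := ⟨0, rfl⟩

variable {T}

theorem IsAncestor.trans {u v w : Fin T.n} (h : T.IsAncestor u v) (h' : T.IsAncestor v w) :
    T.IsAncestor u w := by
  obtain ⟨k, rfl⟩ := h
  obtain ⟨j, rfl⟩ := h'
  exact ⟨k + j, Function.iterate_add_apply _ _ _ _⟩

theorem IsAncestor.antisymm {u v : Fin T.n} (h : T.IsAncestor u v) (h' : T.IsAncestor v u) :
    u = v := by
  obtain ⟨k, hk⟩ := h
  obtain ⟨j, hj⟩ := h'
  rcases Nat.eq_zero_or_pos k with rfl | hk0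
  · exact hk.symm
  have hroot : ∀ i, T.parent^[i] T.root = T.root := fun i =>
    Function.iterate_fixed T.parent_root i
  have hper : T.parent^[j + k] v = v := by rw [Function.iterate_add_apply, hk, hj]
  obtain ⟨m, hm⟩ := T.reaches_root v
  have hv : v = T.root := by
    have h1 : T.parent^[(j + k) * m] v = v := by
      rw [Function.iterate_mul]
      exact Function.iterate_fixed hper m
    obtain ⟨i, hi⟩ : ∃ i, (j + k) * m = i + m :=
      ⟨(j + k) * m - m, (Nat.sub_add_cancel (Nat.le_mul_of_pos_left m (by omega))).symm⟩
    rw [hi, Function.iterate_add_apply, hm, hroot] at h1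
    exact h1.symm
  rw [← hk, hv, hroot]

theorem IsAncestor.total {u v x : Fin T.n} (h : T.IsAncestor u x) (h' : T.IsAncestor v x) :
    T.IsAncestor u v ∨ T.IsAncestor v u := by
  obtain ⟨k, rfl⟩ := h
  obtain ⟨j, rfl⟩ := h'
  rcases le_total j k with hjk | hjk
  · exact .inl ⟨k - j, by rw [← Function.iterate_add_apply, Nat.sub_add_cancel hjk]⟩
  · exact .inr ⟨j - k, by rw [← Function.iterate_add_apply, Nat.sub_add_cancel hjk]⟩

/-- `u` is a child of `v`. -/
def IsChild (T : FinRootedTree) (u v : Fin T.n) : Prop := T.parent u = v ∧ u ≠ v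

theorem IsChild.isAncestor {u v : Fin T.n} (h : T.IsChild u v) : T.IsAncestor v u := ⟨1, h.1⟩

theorem IsChild.eq_or_isAncestor {a v x : Fin T.n} (h : T.IsChild a v) (hx : T.IsAncestor x a) :
    x = a ∨ T.IsAncestor x v := by
  obtain ⟨_ | k, hk⟩ := hx
  · exact .inl hk.symm
  · exact .inr ⟨k, by rw [← h.1, ← hk, Function.iterate_succ_apply]⟩

theorem IsChild.not_isAncestor {a v : Fin T.n} (h : T.IsChild a v) : ¬ T.IsAncestor a v :=
  fun h' => h.2 (h'.antisymm h.isAncestor)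

theorem IsChild.eq_of_isAncestor {a b v x : Fin T.n} (ha : T.IsChild a v) (hb : T.IsChild b v)
    (hax : T.IsAncestor a x) (hbx : T.IsAncestor b x) : a = b := by
  rcases hax.total hbx with h | h
  · exact (hb.eq_or_isAncestor h).resolve_right ha.not_isAncestor
  · exact ((ha.eq_or_isAncestor h).resolve_right hb.not_isAncestor).symm

theorem IsAncestor.eq_or_exists_isChild {v x : Fin T.n} (h : T.IsAncestor v x) :
    x = v ∨ ∃ a, T.IsChild a v ∧ T.IsAncestor a x := by
  obtain ⟨k, hk⟩ := h
  induction k generalizing v with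
  | zero => exact .inl hk
  | succ k ih =>
    rw [Function.iterate_succ_apply'] at hk
    by_cases hv : T.parent^[k] x = v
    · exact ih hv
    · exact .inr ⟨_, ⟨hk, hv⟩, k, rfl⟩

/-- The vertices of the subtree below `v`. -/
def below (T : FinRootedTree) (v : Fin T.n) : Set (Fin T.n) := {x | T.IsAncestor v x}

theorem mem_below {v x : Fin T.n} : x ∈ T.below v ↔ T.IsAncestor v x := Iff.rfl

theorem below_eq_singleton {v : Fin T.n} (h : ∀ a, ¬ T.IsChild a v) : T.below v = {v} := by
  ext x
  refine ⟨fun hx => ?_, ?_⟩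
  · exact (IsAncestor.eq_or_exists_isChild hx).resolve_right fun ⟨a, ha, _⟩ => h a ha
  · rintro rfl
    exact T.isAncestor_refl x

/-- The part of the subtree below `v` outside `v` and the subtree below a child `a`. -/
def sideBelow (T : FinRootedTree) (v a : Fin T.n) : Set (Fin T.n) :=
  {x | T.IsAncestor v x ∧ x ≠ v ∧ ¬ T.IsAncestor a x}

theorem sideBelow_eq (hT : T.IsBinary) {v a : Fin T.n} (ha : T.IsChild a v) :
    T.sideBelow v a = ∅ ∨ ∃ b, T.IsChild b v ∧ T.sideBelow v a = T.below b := by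
  by_cases hb : ∃ b, T.IsChild b v ∧ b ≠ a
  · obtain ⟨b, hb, hba⟩ := hb
    refine .inr ⟨b, hb, Set.ext fun x => ⟨fun ⟨hx, hxv, hxa⟩ => ?_, fun hx => ?_⟩⟩
    · obtain ⟨d, hd, hdx⟩ := hx.eq_or_exists_isChild.resolve_left hxv
      by_cases hdb : d = b
      · exact hdb ▸ hdx
      · have hda : d ≠ a := fun h => hxa (h ▸ hdx)
        have h3 : ({a, b, d} : Set (Fin T.n)).ncard = 3 :=
          Set.ncard_eq_three.2 ⟨a, b, d, hba.symm, hda.symm, fun h => hdb h.symm, rfl⟩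
        have hsub : ({a, b, d} : Set (Fin T.n)) ⊆ {u | T.parent u = v ∧ u ≠ v} := by
          rintro u (rfl | rfl | rfl)
          exacts [ha, hb, hd]
        have := Set.ncard_le_ncard hsub (Set.toFinite _)
        have := hT v
        omega
    · refine ⟨hb.isAncestor.trans hx, ?_, fun hax => hba (hb.eq_of_isAncestor ha hx hax)⟩
      rintro rfl
      exact hb.not_isAncestor hx
  · left
    refine Set.eq_empty_of_forall_notMem fun x ⟨hx, hxv, hxa⟩ => ?_
    obtain ⟨d, hd, hdx⟩ := hx.eq_or_exists_isChild.resolve_left hxv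
    exact hb ⟨d, hd, fun h => hxa (h ▸ hdx)⟩

theorem ncard_below_eq {v a : Fin T.n} (ha : T.IsChild a v) :
    (T.below v).ncard = 1 + (T.sideBelow v a).ncard + (T.below a).ncard := by
  have h : T.below v = insert v (T.sideBelow v a ∪ T.below a) := by
    ext x
    simp only [mem_below, sideBelow, Set.mem_insert_iff, Set.mem_union, Set.mem_ofPred_eq]
    constructor
    · tauto
    · rintro (rfl | h | h)
      exacts [T.isAncestor_refl x, h.1, ha.isAncestor.trans h]
  rw [h, Set.ncard_insert_of_notMem _ (Set.toFinite _),
    Set.ncard_union_eq _ (Set.toFinite _) (Set.toFinite _)]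
  · omega
  · exact Set.disjoint_left.2 fun x hx hx' => hx.2.2 hx'
  · rintro (h | h)
    exacts [h.2.1 rfl, ha.not_isAncestor h]

/-- `g` embeds the vertices in `D` into a shape, preserving nearest common ancestors. -/
structure IsRep (T : FinRootedTree) (D : Set (Fin T.n)) (t : BinShape)
    (g : Fin T.n → List Bool) : Prop where
  mem : ∀ x ∈ D, g x ∈ t.addr
  inj : ∀ x ∈ D, ∀ y ∈ D, g x = g y → x = y
  map_nca : ∀ x ∈ D, ∀ y ∈ D, ∀ z, T.IsNCA x y z → g z = lcp (g x) (g y)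

theorem IsRep.empty (g : Fin T.n → List Bool) : T.IsRep ∅ .nil g :=
  ⟨by simp, by simp, by simp⟩

theorem IsRep.singleton {v : Fin T.n} (h : T.below v = {v}) :
    T.IsRep (T.below v) (.node .nil .nil) fun _ => [] := by
  rw [h]
  exact ⟨by simp, by simp, by simp⟩

theorem IsNCA.symm {x y z : Fin T.n} (h : T.IsNCA x y z) : T.IsNCA y x z :=
  ⟨h.2.1, h.1, fun u hu hu' => h.2.2 u hu' hu⟩

open Classical in
/-- The addresses below `v` obtained from those below its child `a` and those in the rest. -/
noncomputable def joinMap (T : FinRootedTree) (v a : Fin T.n) (g₁ g₂ : Fin T.n → List Bool)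
    (x : Fin T.n) : List Bool :=
  if x = v then [] else if T.IsAncestor a x then true :: g₂ x else false :: g₁ x

theorem IsRep.join (hT : T.IsBinary) {v a : Fin T.n} (ha : T.IsChild a v) {l r : BinShape}
    {g₁ g₂ : Fin T.n → List Bool} (h₁ : T.IsRep (T.sideBelow v a) l g₁)
    (h₂ : T.IsRep (T.below a) r g₂) :
    T.IsRep (T.below v) (.node l r) (T.joinMap v a g₁ g₂) := by
  have fv : T.joinMap v a g₁ g₂ v = [] := by simp [joinMap]
  have fa : ∀ x ∈ T.below a, T.joinMap v a g₁ g₂ x = true :: g₂ x := by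
    intro x hx
    have hxv : x ≠ v := by
      rintro rfl
      exact ha.not_isAncestor hx
    rw [joinMap, if_neg hxv, if_pos (mem_below.1 hx)]
  have fs : ∀ x ∈ T.sideBelow v a, T.joinMap v a g₁ g₂ x = false :: g₁ x := by
    intro x hx
    rw [joinMap, if_neg hx.2.1, if_neg hx.2.2]
  have hcases : ∀ x ∈ T.below v, x = v ∨ x ∈ T.sideBelow v a ∨ x ∈ T.below a := by
    intro x hx
    by_cases hxv : x = v
    · exact .inl hxv
    · by_cases hxa : x ∈ T.below a
      · exact .inr (.inr hxa)
      · exact .inr (.inl ⟨hx, hxv, hxa⟩)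
  have nca_v : ∀ x ∈ T.below v, ∀ z, T.IsNCA v x z → z = v := fun x hx z hz =>
    IsAncestor.antisymm hz.1 (hz.2.2 v (T.isAncestor_refl v) hx)
  have nca_sa : ∀ x ∈ T.sideBelow v a, ∀ y ∈ T.below a, ∀ z, T.IsNCA x y z → z = v := by
    intro x hx y hy z hz
    have hvz : T.IsAncestor v z := hz.2.2 v hx.1 (ha.isAncestor.trans hy)
    refine (IsAncestor.eq_or_exists_isChild hvz).resolve_right fun ⟨d, hd, hdz⟩ => hx.2.2 ?_
    rw [ha.eq_of_isAncestor hd hy (hdz.trans hz.2.1)]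
    exact hdz.trans hz.1
  refine ⟨fun x hx => ?_, fun x hx y hy hxy => ?_, fun x hx y hy z hz => ?_⟩
  · rcases hcases x hx with rfl | hx | hx
    · simp [fv]
    · simpa [fs x hx] using h₁.mem x hx
    · simpa [fa x hx] using h₂.mem x hx
  · rcases hcases x hx with hx' | hx' | hx' <;> rcases hcases y hy with hy' | hy' | hy'
    · rw [hx', hy']
    · simp [hx', fv, fs y hy'] at hxy
    · simp [hx', fv, fa y hy'] at hxy
    · simp [hy', fv, fs x hx'] at hxy
    · exact h₁.inj x hx' y hy' (by simpa [fs x hx', fs y hy'] using hxy)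
    · simp [fs x hx', fa y hy'] at hxy
    · simp [hy', fv, fa x hx'] at hxy
    · simp [fa x hx', fs y hy'] at hxy
    · exact h₂.inj x hx' y hy' (by simpa [fa x hx', fa y hy'] using hxy)
  · rcases hcases x hx with rfl | hx' | hx'
    · simp [nca_v y hy z hz, fv]
    · rcases hcases y hy with rfl | hy' | hy'
      · simp [nca_v x hx z hz.symm, fv]
      · have hz' : z ∈ T.sideBelow v a := by
          rcases sideBelow_eq hT ha with h | ⟨b, hb, h⟩
          · simp [h] at hx'
          · rw [h] at hx' hy' ⊢
            exact hz.2.2 b hx' hy'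
        simpa [fs x hx', fs y hy', fs z hz'] using h₁.map_nca x hx' y hy' z hz
      · simp [nca_sa x hx' y hy' z hz, fv, fs x hx', fa y hy']
    · rcases hcases y hy with rfl | hy' | hy'
      · simp [nca_v x hx z hz.symm, fv]
      · simp [nca_sa y hy' x hx' z hz.symm, fv, fs y hy', fa x hx']
      · have hz' : z ∈ T.below a := hz.2.2 a hx' hy'
        simpa [fa x hx', fa y hy', fa z hz'] using h₂.map_nca x hx' y hy' z hz

theorem exists_isRep_below (hT : T.IsBinary) (v : Fin T.n) :
    ∃ t g, t.size = (T.below v).ncard ∧ T.IsRep (T.below v) t g := by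
  induction hk : (T.below v).ncard using Nat.strong_induction_on generalizing v with
  | _ k ih =>
  subst hk
  by_cases hv : ∃ a, T.IsChild a v
  · obtain ⟨a, ha⟩ := hv
    have hcard := ncard_below_eq ha
    obtain ⟨r, g₂, hr, h₂⟩ := ih _ (by omega) a rfl
    obtain ⟨l, g₁, hl, h₁⟩ :
        ∃ t g, t.size = (T.sideBelow v a).ncard ∧ T.IsRep (T.sideBelow v a) t g := by
      rcases sideBelow_eq hT ha with h | ⟨b, hb, h⟩
      · rw [h]
        exact ⟨.nil, fun _ => [], by simp [size], .empty _⟩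
      · rw [h] at hcard ⊢
        exact ih _ (by omega) b rfl
    exact ⟨.node l r, _, by rw [size, hl, hr, hcard], h₁.join hT ha h₂⟩
  · have h := below_eq_singleton (not_exists.1 hv)
    exact ⟨_, _, by simp [h, size], .singleton h⟩

theorem exists_isRep_sideBelow (hT : T.IsBinary) {v a : Fin T.n} (ha : T.IsChild a v) :
    ∃ t g, t.size = (T.sideBelow v a).ncard ∧ T.IsRep (T.sideBelow v a) t g := by
  rcases sideBelow_eq hT ha with h | ⟨b, hb, h⟩
  · rw [h]
    exact ⟨.nil, fun _ => [], by simp [size], .empty _⟩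
  · rw [h]
    exact exists_isRep_below hT b

theorem exists_isRep_plug (hT : T.IsBinary) {w : Fin T.n} (hw : T.IsLeaf w) (v : Fin T.n)
    (hvw : T.IsAncestor v w) :
    ∃ c g, cost c + 1 = (T.below v).ncard ∧
      T.IsRep (T.below v) (plug c (.node .nil .nil)) g ∧ g w = List.replicate c.length true := by
  induction hk : (T.below v).ncard using Nat.strong_induction_on generalizing v with
  | _ k ih =>
  subst hk
  rcases hvw.eq_or_exists_isChild with rfl | ⟨a, ha, haw⟩
  · have h : T.below w = {w} := below_eq_singleton fun a ha => ha.2 (hw a ha.1)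
    exact ⟨[], _, by simp [h], .singleton h, rfl⟩
  · have hcard := ncard_below_eq ha
    obtain ⟨c, g₂, hc, h₂, hm⟩ := ih _ (by omega) a haw rfl
    obtain ⟨t, g₁, ht, h₁⟩ := exists_isRep_sideBelow hT ha
    refine ⟨t :: c, _, ?_, h₁.join hT ha h₂, ?_⟩
    · rw [cost_cons, hcard]
      omega
    · have hwv : w ≠ v := by
        rintro rfl
        exact ha.not_isAncestor haw
      rw [joinMap, if_neg hwv, if_pos haw, hm, List.length_cons, List.replicate_succ]

end FinRootedTree

open BinShape in
/-- For every `n ≥ 1` there is a rooted tree `S'` with at most `2 n ^ 2 - 1` vertices and one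
marked leaf `w` that is NCA-universal for the family of all rooted binary trees on at most `n`
vertices with one marked leaf: the embedding maps marked leaf to marked leaf. -/
theorem nca_universal_tree_binary_marked (n : ℕ) (hn : 1 ≤ n) :
    ∃ (S' : FinRootedTree) (w : Fin S'.n), S'.IsLeaf w ∧ S'.n ≤ 2 * n ^ 2 - 1 ∧
      ∀ (T : FinRootedTree) (wT : Fin T.n), T.IsBinary → T.IsLeaf wT → T.n ≤ n →
        ∃ φ : Fin T.n → Fin S'.n, NcaEmbedding T S' φ ∧ φ wT = w := by
  obtain ⟨C, hC, uC⟩ := (exists_universal n).2 hn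
  have h0 : [] ∈ (plug C (.node .nil .nil)).addr :=
    mem_addr_of_prefix List.nil_prefix (replicate_mem_addr_plug C)
  refine ⟨(plug C (.node .nil .nil)).toTree h0, _, isLeaf_vertex C h0, ?_, ?_⟩
  · change (plug C (.node .nil .nil)).addr.card ≤ _
    rw [card_addr, size_plug]
    simp only [size]
    omega
  · intro T w hT hw hTn
    have hroot : T.below T.root = Set.univ := Set.eq_univ_of_forall fun v => T.reaches_root v
    obtain ⟨c, g, hc, hg, hm⟩ := FinRootedTree.exists_isRep_plug hT hw T.root (T.reaches_root w)
    rw [hroot] at hc hg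
    rw [Set.ncard_univ, Nat.card_fin] at hc
    obtain ⟨f, hf, hfm⟩ := (IsEmb.id (.node .nil .nil)).plug (uC c (by omega))
    refine ⟨fun v => (plug C (.node .nil .nil)).vertex h0
      ⟨f (g v), hf.mem _ (hg.mem v (Set.mem_univ v))⟩, ⟨fun u v huv => ?_, fun u v z hz => ?_⟩, ?_⟩
    · have h : f (g u) = f (g v) := congrArg Subtype.val (((plug C _).vertex h0).injective huv)
      exact hg.inj u (Set.mem_univ u) v (Set.mem_univ v)
        (hf.inj _ (hg.mem u (Set.mem_univ u)) _ (hg.mem v (Set.mem_univ v)) h)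
    · apply isNCA_vertex
      change f (g z) = lcp (f (g u)) (f (g v))
      rw [hg.map_nca u (Set.mem_univ u) v (Set.mem_univ v) z hz]
      exact hf.map_lcp _ (hg.mem u (Set.mem_univ u)) _ (hg.mem v (Set.mem_univ v))
    · have h := hfm []
      simp only [List.append_nil, id, ← hm] at h
      exact congrArg _ (Subtype.ext h)
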